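/- Let g ≥ 3 be an integer and let F : ℝ^{n+2} → ℝ be an isoparametric polynomial of degree g, i.e. the evaluation of a homogeneous polynomial of degree g satisfying ‖∇F(x)‖² = g²·‖x‖^{2g−2} and ΔF(x) = c·‖x‖^{g−2} for all x, for some constant c ∈ ℝ. Then for every p ∈ S^{n+1} with F(p) = cos(2π/g), the gradient map Φ := (1/g)·∇F satisfies F(Φ(p)) = F(p); that is, the isoparametric hypersurface M_{cos(2π/g)} is mapped by Φ into itself. (If g = 2 one has F(Φ(p)) = F(p) for every p ∈ S^{n+1}.) Thus Φ provides a homogeneous polynomial self-map of a certain isoparametric hypersurface. -/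

import Mathlib

open Real

/-- The Euclidean Laplacian of a function on a finite-dimensional real inner product space,
computed as the sum of second derivatives along an orthonormal basis. -/
noncomputable def laplacian {E : Type*} [NormedAddCommGroup E] [InnerProductSpace ℝ E]
    [FiniteDimensional ℝ E] (f : E → ℝ) (x : E) : ℝ :=
  ∑ i, iteratedFDeriv ℝ 2 f x ![stdOrthonormalBasis ℝ E i, stdOrthonormalBasis ℝ E i]

open scoped RealInnerProductSpace

/-- Evaluation of a homogeneous polynomial at a scaled point. -/
theorem MvPolynomial.IsHomogeneous.eval_smul {σ R : Type*} [CommSemiring R]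
    {P : MvPolynomial σ R} {d : ℕ} (hP : P.IsHomogeneous d) (r : R) (x : σ → R) :
    eval (r • x) P = r ^ d * eval x P := by
  rw [eval_eq, eval_eq, Finset.mul_sum]
  refine Finset.sum_congr rfl fun m hm ↦ ?_
  have hdeg : ∑ i ∈ m.support, m i = d := by
    rw [← hP (mem_support_iff.mp hm), Finsupp.weight_apply, Finsupp.sum]
    simp
  simp only [Pi.smul_apply, smul_eq_mul, mul_pow, Finset.prod_mul_distrib,
    Finset.prod_pow_eq_pow_sum, hdeg]
  ring

section GradientMap

variable {E : Type*} [NormedAddCommGroup E] [InnerProductSpace ℝ E] [CompleteSpace E]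

theorem ContDiff.gradient {F : E → ℝ} {m n : WithTop ℕ∞} (hF : ContDiff ℝ n F) (hmn : m + 1 ≤ n) :
    ContDiff ℝ m (gradient F) := by
  let L : (E →L[ℝ] ℝ) →ₗᵢ[ℝ] E :=
    { toFun := (InnerProductSpace.toDual ℝ E).symm
      map_add' := by simp
      map_smul' := by simp
      norm_map' := by simp }
  exact L.contDiff.comp (hF.fderiv_right hmn)

theorem inner_fderiv_gradient_left {F : E → ℝ} (hF : ContDiff ℝ 2 F) (x v w : E) :
    ⟪fderiv ℝ (gradient F) x v, w⟫ = fderiv ℝ (fderiv ℝ F) x v w := by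
  have hG : DifferentiableAt ℝ (gradient F) x :=
    (hF.gradient (m := 1) (by norm_num [one_add_one_eq_two])).differentiable (by simp) x
  have hD : DifferentiableAt ℝ (fderiv ℝ F) x :=
    (hF.fderiv_right (m := 1) (by norm_num [one_add_one_eq_two])).differentiable (by simp) x
  have h₁ := hG.hasFDerivAt.inner ℝ (hasFDerivAt_const w x)
  have h₂ := hD.hasFDerivAt.clm_apply (hasFDerivAt_const w x)
  simp only [inner_gradient_left] at h₁
  simpa using DFunLike.congr_fun (h₁.unique h₂) v

theorem inner_fderiv_gradient_comm {F : E → ℝ} (hF : ContDiff ℝ 2 F) (x v w : E) :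
    ⟪fderiv ℝ (gradient F) x v, w⟫ = ⟪fderiv ℝ (gradient F) x w, v⟫ := by
  rw [inner_fderiv_gradient_left hF, inner_fderiv_gradient_left hF]
  exact hF.contDiffAt.isSymmSndFDerivAt (by simp) v w

/-- Euler's identity. -/
theorem inner_gradient_self {F : E → ℝ} {g : ℕ} (hF : Differentiable ℝ F)
    (hhom : ∀ (r : ℝ) x, F (r • x) = r ^ g * F x) (x : E) : ⟪gradient F x, x⟫ = g * F x := by
  have h₁ : HasDerivAt (fun r : ℝ ↦ r • x) x 1 := by
    simpa using (hasDerivAt_id (1 : ℝ)).smul_const x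
  have h₂ : HasDerivAt (fun r : ℝ ↦ F (r • x)) (fderiv ℝ F x x) 1 := by
    have hFx : HasFDerivAt F (fderiv ℝ F x) ((1 : ℝ) • x) := by
      simpa using (hF x).hasFDerivAt
    exact hFx.comp_hasDerivAt 1 h₁
  have h₃ : HasDerivAt (fun r : ℝ ↦ F (r • x)) (g * F x) 1 := by
    simp only [hhom]
    simpa using (hasDerivAt_pow g (1 : ℝ)).mul_const (F x)
  rw [inner_gradient_left, h₂.unique h₃]

theorem fderiv_gradient_self {F : E → ℝ} {g : ℕ} (hF : ContDiff ℝ 2 F)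
    (hhom : ∀ (r : ℝ) x, F (r • x) = r ^ g * F x) (x : E) :
    fderiv ℝ (gradient F) x x = ((g : ℝ) - 1) • gradient F x := by
  have hFd : Differentiable ℝ F := hF.differentiable (by simp)
  have hG : DifferentiableAt ℝ (gradient F) x :=
    (hF.gradient (m := 1) (by norm_num [one_add_one_eq_two])).differentiable (by simp) x
  have h₁ := hG.hasFDerivAt.inner ℝ (hasFDerivAt_id x)
  have h₂ := (hFd x).hasFDerivAt.const_mul (g : ℝ)
  simp only [id, inner_gradient_self hFd hhom] at h₁
  refine ext_inner_right ℝ fun v ↦ ?_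
  have h := DFunLike.congr_fun (h₁.unique h₂) v
  simp [inner_gradient_left] at h
  rw [inner_fderiv_gradient_comm hF, inner_smul_left, inner_gradient_left]
  simp
  linarith

theorem fderiv_gradient_gradient {F : E → ℝ} {g : ℕ} (hg : 1 ≤ g) (hF : ContDiff ℝ 2 F)
    (heik : ∀ x, ‖gradient F x‖ ^ 2 = (g : ℝ) ^ 2 * ‖x‖ ^ (2 * g - 2)) {x : E} (hx : ‖x‖ = 1) :
    fderiv ℝ (gradient F) x (gradient F x) = ((g : ℝ) ^ 2 * ((g : ℝ) - 1)) • x := by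
  have hG : DifferentiableAt ℝ (gradient F) x :=
    (hF.gradient (m := 1) (by norm_num [one_add_one_eq_two])).differentiable (by simp) x
  have h₁ := hG.hasFDerivAt.norm_sq
  have h₂ := (((hasFDerivAt_id x).norm_sq).pow (g - 1)).const_mul ((g : ℝ) ^ 2)
  have heq : (fun y ↦ ‖gradient F y‖ ^ 2) = fun y ↦ (g : ℝ) ^ 2 * (‖id y‖ ^ 2) ^ (g - 1) := by
    funext y
    rw [heik, id, ← pow_mul, Nat.mul_sub, mul_one]
  rw [heq] at h₁
  refine ext_inner_right ℝ fun v ↦ ?_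
  have h := DFunLike.congr_fun (h₁.unique h₂) v
  simp [hx, Nat.cast_sub hg] at h
  rw [inner_fderiv_gradient_comm hF, inner_smul_left, real_inner_comm]
  simp
  linarith

/-- Along the normal great circle through a regular point, a solution of the Cartan–Münzner
gradient equation is a cosine. -/
theorem apply_greatCircle {F : E → ℝ} {g : ℕ} (hg : 1 ≤ g) (hF : AnalyticOnNhd ℝ F Set.univ)
    (hhom : ∀ (r : ℝ) x, F (r • x) = r ^ g * F x)
    (heik : ∀ x, ‖gradient F x‖ ^ 2 = (g : ℝ) ^ 2 * ‖x‖ ^ (2 * g - 2))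
    {p ξ : E} {α : ℝ} (hp : ‖p‖ = 1) (hξ : ‖ξ‖ = 1) (hpξ : ⟪p, ξ⟫ = 0) (hα : sin α ≠ 0)
    (hgrad : gradient F p = ((g : ℝ) * cos α) • p + ((g : ℝ) * sin α) • ξ) (t : ℝ) :
    F (cos t • p + sin t • ξ) = cos (g * t - α) := by
  have hg₀ : (g : ℝ) ≠ 0 := by positivity
  have hF2 : ContDiff ℝ 2 F := hF.contDiff
  have hFd : Differentiable ℝ F := hF2.differentiable (by simp)
  have hG1 : ContDiff ℝ 1 (gradient F) := hF2.gradient (by norm_num [one_add_one_eq_two])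
  set γ : ℝ → E := fun t ↦ cos t • p + sin t • ξ with hγ
  set γ' : ℝ → E := fun t ↦ -sin t • p + cos t • ξ with hγ'
  set a : ℝ → ℝ := fun t ↦ g * cos (g * t - α) with ha
  set b : ℝ → ℝ := fun t ↦ -(g * sin (g * t - α)) with hb
  set H : ℝ → E →L[ℝ] E := fun t ↦ fderiv ℝ (gradient F) (γ t)
  have hγd (t) : HasDerivAt γ (γ' t) t :=
    ((hasDerivAt_cos t).smul_const p).add ((hasDerivAt_sin t).smul_const ξ)
  have hγ'd (t) : HasDerivAt γ' (-γ t) t := by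
    refine ((((hasDerivAt_sin t).neg).smul_const p).add
      ((hasDerivAt_cos t).smul_const ξ)).congr_deriv ?_
    simp only [hγ]; module
  have harg (t : ℝ) : HasDerivAt (fun t : ℝ ↦ (g : ℝ) * t - α) g t := by
    simpa using ((hasDerivAt_id t).const_mul (g : ℝ)).sub_const α
  have had (t) : HasDerivAt a (g * b t) t := by
    refine (((harg t).cos).const_mul (g : ℝ)).congr_deriv ?_
    simp only [hb]; ring
  have hbd (t) : HasDerivAt b (-(g * a t)) t := by
    refine ((((harg t).sin).const_mul (g : ℝ)).neg).congr_deriv ?_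
    simp only [ha]; ring
  have hab (t) : (g : ℝ) ^ 2 = a t ^ 2 + b t ^ 2 := by
    simp only [ha, hb]; linear_combination -(g : ℝ) ^ 2 * sin_sq_add_cos_sq (g * t - α)
  have hγn (t) : ‖γ t‖ = 1 := by
    have h := norm_add_sq_real (cos t • p) (sin t • ξ)
    simp only [inner_smul_left, inner_smul_right, hpξ, norm_smul, hp, hξ, mul_one,
      Real.norm_eq_abs, sq_abs, mul_zero, add_zero, cos_sq_add_sin_sq] at h
    exact (sq_eq_sq₀ (norm_nonneg _) zero_le_one).mp (by rw [h, one_pow])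
  have hpp : ⟪p, p⟫ = 1 := by rw [real_inner_self_eq_norm_sq, hp, one_pow]
  have hξξ : ⟪ξ, ξ⟫ = 1 := by rw [real_inner_self_eq_norm_sq, hξ, one_pow]
  have hξp : ⟪ξ, p⟫ = 0 := by rw [real_inner_comm, hpξ]
  have hγγ' (t) : ⟪γ' t, γ t⟫ = 0 := by
    simp only [hγ, hγ', inner_add_left, inner_add_right, inner_smul_left, inner_smul_right,
      hpp, hξξ, hξp, hpξ, conj_trivial]
    ring
  have hγγ (t) : ⟪γ t, γ t⟫ = 1 := by rw [real_inner_self_eq_norm_sq, hγn, one_pow]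
  let Δ : ℝ → E := fun t ↦ gradient F (γ t) - (a t • γ t + b t • γ' t)
  let v : ℝ → E → E := fun t y ↦ (-(b t)⁻¹) • (H t y + (a t * (g - 1)) • y)
  have hΔd (t) (ht : b t ≠ 0) : HasDerivAt Δ (v t (Δ t)) t := by
    have h₁ : HasDerivAt (fun t ↦ gradient F (γ t)) (H t (γ' t)) t :=
      ((hG1.differentiable (by simp) (γ t)).hasFDerivAt).comp_hasDerivAt t (hγd t)
    have h₂ := ((had t).smul (hγd t)).add ((hbd t).smul (hγ'd t))
    refine (h₁.sub h₂).congr_deriv ?_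
    have hHγ : H t (γ t) = ((g : ℝ) - 1) • gradient F (γ t) := fderiv_gradient_self hF2 hhom _
    have hHG : H t (gradient F (γ t)) = ((a t ^ 2 + b t ^ 2) * ((g : ℝ) - 1)) • γ t := by
      rw [← hab]; exact fderiv_gradient_gradient hg hF2 heik (hγn t)
    simp only [v, Δ, map_sub, map_add, map_smul, hHγ, hHG]
    match_scalars <;> field_simp <;> ring
  have hb0 : b 0 ≠ 0 := by simp [hb, hg₀, hα]
  have hbc : Continuous b := by fun_prop
  have hac : Continuous a := by fun_prop
  have hγc : Continuous γ := by fun_prop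
  have hHc : Continuous H := (hG1.continuous_fderiv (by simp)).comp hγc
  have hbne : ∀ᶠ t in nhds 0, b t ≠ 0 := hbc.continuousAt.eventually_ne hb0
  let V : ℝ → E →L[ℝ] E := fun t ↦
    (-(b t)⁻¹) • (H t + (a t * (g - 1)) • ContinuousLinearMap.id ℝ E)
  have hVc : ContinuousAt V 0 := by
    have h := hbc.continuousAt.inv₀ hb0
    exact h.neg.smul (hHc.continuousAt.add
      ((hac.continuousAt.mul continuousAt_const).smul continuousAt_const))
  have hvL : ∀ᶠ t in nhds 0, LipschitzOnWith (‖V 0‖₊ + 1) (v t) Set.univ := by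
    have h : ∀ᶠ t in nhds 0, ‖V t‖₊ < ‖V 0‖₊ + 1 :=
      hVc.nnnorm.eventually_lt continuousAt_const (lt_add_one _)
    filter_upwards [h] with t ht
    exact ((V t).lipschitz.weaken ht.le).lipschitzOnWith
  have hΔ : Δ =ᶠ[nhds 0] fun _ ↦ 0 := by
    refine ODE_solution_unique_of_eventually (v := v) (s := fun _ ↦ Set.univ) hvL ?_ ?_ ?_
    · filter_upwards [hbne] with t ht using ⟨hΔd t ht, trivial⟩
    · refine .of_forall fun t ↦ ⟨?_, trivial⟩
      simpa [v] using hasDerivAt_const t (0 : E)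
    · simp [Δ, hγ, hγ', ha, hb, hgrad]
  have hloc : (fun t ↦ F (γ t)) =ᶠ[nhds 0] fun t ↦ cos (g * t - α) := by
    filter_upwards [hΔ] with t ht
    have h := inner_gradient_self hFd hhom (γ t)
    rw [sub_eq_zero.mp ht, inner_add_left, inner_smul_left, inner_smul_left, hγγ, hγγ'] at h
    simp only [ha, conj_trivial, mul_one, mul_zero, add_zero] at h
    exact (mul_left_cancel₀ hg₀ h).symm
  have hγa : AnalyticOnNhd ℝ γ Set.univ := fun t _ ↦
    ((analyticAt_cos).smul analyticAt_const).add ((analyticAt_sin).smul analyticAt_const)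
  have hca : AnalyticOnNhd ℝ (fun t ↦ cos (g * t - α)) Set.univ := fun t _ ↦
    (analyticAt_cos).comp_of_eq
      ((analyticAt_const.mul analyticAt_id).sub analyticAt_const) rfl
  exact congrFun ((hF.comp hγa (Set.mapsTo_univ _ _)).eq_of_eventuallyEq hca hloc) t

variable {F : E → ℝ} {g : ℕ}

theorem norm_gradientMap (hg : 1 ≤ g)
    (heik : ∀ x, ‖gradient F x‖ ^ 2 = (g : ℝ) ^ 2 * ‖x‖ ^ (2 * g - 2)) {p : E} (hp : ‖p‖ = 1) :
    ‖(g : ℝ)⁻¹ • gradient F p‖ = 1 := by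
  have hg₀ : (0 : ℝ) < g := by positivity
  have h := heik p
  rw [hp, one_pow, mul_one, sq_eq_sq₀ (norm_nonneg _) hg₀.le] at h
  rw [norm_smul, h, norm_inv, Real.norm_of_nonneg hg₀.le, inv_mul_cancel₀ hg₀.ne']

theorem inner_gradientMap_self (hg : 1 ≤ g) (hF : Differentiable ℝ F)
    (hhom : ∀ (r : ℝ) x, F (r • x) = r ^ g * F x) (p : E) :
    ⟪(g : ℝ)⁻¹ • gradient F p, p⟫ = F p := by
  have hg₀ : (g : ℝ) ≠ 0 := by positivity
  rw [inner_smul_left, inner_gradient_self hF hhom, conj_trivial, inv_mul_cancel_left₀ hg₀]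

/-- The gradient map sends a regular level `cos α` to the level `cos ((g - 1) α)`. -/
theorem apply_gradientMap (hg : 1 ≤ g) (hF : AnalyticOnNhd ℝ F Set.univ)
    (hhom : ∀ (r : ℝ) x, F (r • x) = r ^ g * F x)
    (heik : ∀ x, ‖gradient F x‖ ^ 2 = (g : ℝ) ^ 2 * ‖x‖ ^ (2 * g - 2))
    {p : E} {α : ℝ} (hp : ‖p‖ = 1) (hFp : F p = cos α) (hα : sin α ≠ 0) :
    F ((g : ℝ)⁻¹ • gradient F p) = cos (g * α - α) := by
  have hg₀ : (g : ℝ) ≠ 0 := by positivity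
  have hFd : Differentiable ℝ F := (hF.contDiff (n := 2)).differentiable (by simp)
  have hn := norm_gradientMap hg heik hp
  have hi := inner_gradientMap_self hg hFd hhom p
  have hgr : gradient F p = (g : ℝ) • ((g : ℝ)⁻¹ • gradient F p) := by
    rw [smul_inv_smul₀ hg₀]
  generalize (g : ℝ)⁻¹ • gradient F p = q at hn hi hgr ⊢
  rw [hFp] at hi
  let ξ : E := (sin α)⁻¹ • (q - cos α • p)
  have hq : cos α • p + sin α • ξ = q := by
    simp only [ξ, smul_inv_smul₀ hα]; abel
  have hpp : ⟪p, p⟫ = 1 := by rw [real_inner_self_eq_norm_sq, hp, one_pow]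
  have hpξ : ⟪p, ξ⟫ = 0 := by
    simp [ξ, inner_smul_right, inner_sub_right, real_inner_comm q p, hi, hp]
  have hqp : ‖q - cos α • p‖ ^ 2 = sin α ^ 2 := by
    rw [norm_sub_sq_real, inner_smul_right, hi, hn, norm_smul, hp, mul_one, Real.norm_eq_abs,
      sq_abs, sin_sq]
    ring
  have hξ : ‖ξ‖ = 1 := by
    rw [← sq_eq_sq₀ (norm_nonneg _) zero_le_one, one_pow, norm_smul, mul_pow, hqp, norm_inv,
      Real.norm_eq_abs, inv_pow, sq_abs, inv_mul_cancel₀ (pow_ne_zero 2 hα)]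
  have h := apply_greatCircle hg hF hhom heik hp hξ hpξ hα
    (by rw [hgr]; nth_rewrite 1 [← hq]; module) α
  rwa [hq] at h

/-- A quadratic isoparametric function is preserved by its gradient map. -/
theorem apply_gradientMap_of_degree_two (hF : AnalyticOnNhd ℝ F Set.univ) (hg : g = 2)
    (hhom : ∀ (r : ℝ) x, F (r • x) = r ^ g * F x)
    (heik : ∀ x, ‖gradient F x‖ ^ 2 = (g : ℝ) ^ 2 * ‖x‖ ^ (2 * g - 2))
    {p : E} (hp : ‖p‖ = 1) : F ((g : ℝ)⁻¹ • gradient F p) = F p := by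
  have hg₁ : 1 ≤ g := by lia
  have hFd : Differentiable ℝ F := (hF.contDiff (n := 2)).differentiable (by simp)
  have hn := norm_gradientMap hg₁ heik hp
  have hi := inner_gradientMap_self hg₁ hFd hhom p
  have hle : |F p| ≤ 1 := by
    simpa [hi, hn, hp] using abs_real_inner_le_norm ((g : ℝ)⁻¹ • gradient F p) p
  have hcos : cos (arccos (F p)) = F p := cos_arccos (abs_le.mp hle).1 (abs_le.mp hle).2
  by_cases hα : sin (arccos (F p)) = 0
  · have hsq : F p ^ 2 = 1 := by
      have h := sin_sq_add_cos_sq (arccos (F p))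
      rw [hα, hcos] at h
      linarith
    have hq : (g : ℝ)⁻¹ • gradient F p = F p • p := by
      rw [← sub_eq_zero, ← norm_eq_zero, ← sq_eq_zero_iff, norm_sub_sq_real, inner_smul_right,
        hi, hn, norm_smul, hp, mul_one, Real.norm_eq_abs, sq_abs]
      linarith
    rw [hq, hhom, hg, hsq, one_mul]
  · rw [apply_gradientMap hg₁ hF hhom heik hp hcos.symm hα, hg, Nat.cast_two, two_mul,
      add_sub_cancel_right, hcos]

end GradientMap

/-- Let `F` be an isoparametric polynomial of degree `g ≥ 2` (a homogeneous
polynomial of degree `g` with `‖∇F(x)‖² = g² ‖x‖^{2g-2}` and `ΔF(x) = c ‖x‖^{g-2}`).  Then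
for every `p` on the unit sphere with `F(p) = cos(2π/g)`, the gradient map `Φ = (1/g) ∇F`
satisfies `F(Φ(p)) = F(p)`: the isoparametric hypersurface `M_{cos(2π/g)}` is mapped by `Φ`
into itself.  (If `g = 2`, one has `F(Φ(p)) = F(p)` for every `p` on the sphere.)  Thus `Φ`
provides a homogeneous polynomial self-map of a certain isoparametric hypersurface. -/
theorem gradientMap_selfMap_of_hypersurface (n g : ℕ) (hg : 2 ≤ g)
    (F : EuclideanSpace ℝ (Fin (n + 2)) → ℝ)
    (P : MvPolynomial (Fin (n + 2)) ℝ) (hP : P.IsHomogeneous g)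
    (hFP : ∀ x, F x = MvPolynomial.eval x P)
    (hCM1 : ∀ x, ‖gradient F x‖ ^ 2 = (g : ℝ) ^ 2 * ‖x‖ ^ (2 * g - 2))
    (c : ℝ) (hCM2 : ∀ x, laplacian F x = c * ‖x‖ ^ (g - 2))
    (Φ : EuclideanSpace ℝ (Fin (n + 2)) → EuclideanSpace ℝ (Fin (n + 2)))
    (hΦ : ∀ x, Φ x = (g : ℝ)⁻¹ • gradient F x) :
    (∀ p : EuclideanSpace ℝ (Fin (n + 2)), ‖p‖ = 1 →
        F p = Real.cos (2 * π / (g : ℝ)) → F (Φ p) = F p) ∧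
      (g = 2 → ∀ p : EuclideanSpace ℝ (Fin (n + 2)), ‖p‖ = 1 → F (Φ p) = F p) := by
  have hFa : AnalyticOnNhd ℝ F Set.univ := by
    have h := AnalyticOnNhd.aeval_mvPolynomial (𝕜 := ℝ)
      (f := fun (x : EuclideanSpace ℝ (Fin (n + 2))) i ↦ x i) (s := Set.univ)
      (fun i x _ ↦ (EuclideanSpace.proj (𝕜 := ℝ) i).analyticAt x) P
    rw [funext hFP]
    simpa [MvPolynomial.aeval_eq_eval] using h
  have hhom (r : ℝ) (x) : F (r • x) = r ^ g * F x := by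
    rw [hFP, hFP, ← hP.eval_smul]
    rfl
  have htwo (h : g = 2) (p : EuclideanSpace ℝ (Fin (n + 2))) (hp : ‖p‖ = 1) : F (Φ p) = F p := by
    rw [hΦ]
    exact apply_gradientMap_of_degree_two hFa h hhom hCM1 hp
  refine ⟨fun p hp hFp ↦ ?_, htwo⟩
  rcases hg.eq_or_lt with h | h
  · exact htwo h.symm p hp
  · have hg₃ : (3 : ℝ) ≤ g := by exact_mod_cast h
    have hg₀ : (0 : ℝ) < g := by linarith
    have hsin : sin (2 * π / g) ≠ 0 := by
      refine (sin_pos_of_pos_of_lt_pi (by positivity) ?_).ne'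
      rw [div_lt_iff₀ hg₀]
      nlinarith [pi_pos]
    rw [hΦ, apply_gradientMap (by lia) hFa hhom hCM1 hp hFp hsin, hFp,
      mul_div_cancel₀ _ hg₀.ne', cos_two_pi_sub]
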